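/- Assume p(0) ≠ 0 and let w ∈ K[z] be the polynomial with p(z) = p(0) − z·w(z). Then the 2×2 matrices over B := A(p;q)₀ given by e(1) = (1/p(0))·[[p(0) − p(q²z), −x], [−w(z)·y, p(z)]] and e(−1) = (1/p(0))·[[p(q²z), x], [w(z)·y, p(0) − p(z)]] — where x := x₋z₊, y := z₋x₊, z := z₋z₊ ∈ B — are idempotents in the matrix algebra M₂(B) satisfying e(1) + e(−1) = 1. -/

import Mathlib

noncomputable section

open Polynomial
open scoped Classical

namespace GWAPaper

variable (K : Type) [Field K]

/-- Defining relations of the generalized Weyl algebra `A(p;q)`; the generators are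
indexed by `Fin 4` with `0 ↦ x₊`, `1 ↦ x₋`, `2 ↦ z₊`, `3 ↦ z₋`. -/
inductive GWARel (q : K) (p : K[X]) :
    FreeAlgebra K (Fin 4) → FreeAlgebra K (Fin 4) → Prop
  | zz : GWARel q p (FreeAlgebra.ι K (2 : Fin 4) * FreeAlgebra.ι K (3 : Fin 4))
      (FreeAlgebra.ι K (3 : Fin 4) * FreeAlgebra.ι K (2 : Fin 4))
  | xpzp : GWARel q p (FreeAlgebra.ι K (0 : Fin 4) * FreeAlgebra.ι K (2 : Fin 4))
      (q⁻¹ • (FreeAlgebra.ι K (2 : Fin 4) * FreeAlgebra.ι K (0 : Fin 4)))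
  | xpzm : GWARel q p (FreeAlgebra.ι K (0 : Fin 4) * FreeAlgebra.ι K (3 : Fin 4))
      (q⁻¹ • (FreeAlgebra.ι K (3 : Fin 4) * FreeAlgebra.ι K (0 : Fin 4)))
  | xmzp : GWARel q p (FreeAlgebra.ι K (1 : Fin 4) * FreeAlgebra.ι K (2 : Fin 4))
      (q • (FreeAlgebra.ι K (2 : Fin 4) * FreeAlgebra.ι K (1 : Fin 4)))
  | xmzm : GWARel q p (FreeAlgebra.ι K (1 : Fin 4) * FreeAlgebra.ι K (3 : Fin 4))
      (q • (FreeAlgebra.ι K (3 : Fin 4) * FreeAlgebra.ι K (1 : Fin 4)))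
  | xpxm : GWARel q p (FreeAlgebra.ι K (0 : Fin 4) * FreeAlgebra.ι K (1 : Fin 4))
      (Polynomial.aeval (FreeAlgebra.ι K (2 : Fin 4) * FreeAlgebra.ι K (3 : Fin 4)) p)
  | xmxp : GWARel q p (FreeAlgebra.ι K (1 : Fin 4) * FreeAlgebra.ι K (0 : Fin 4))
      (Polynomial.aeval ((q ^ 2 : K) • (FreeAlgebra.ι K (3 : Fin 4) * FreeAlgebra.ι K (2 : Fin 4))) p)

/-- The generalized Weyl algebra `A(p;q)`. -/
abbrev GWA (q : K) (p : K[X]) : Type := RingQuot (GWARel K q p)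

/-- The images of the four generators in `A(p;q)`. -/
def gwaGen (q : K) (p : K[X]) (i : Fin 4) : GWA K q p :=
  RingQuot.mkAlgHom K (GWARel K q p) (FreeAlgebra.ι K i)

/-- The generator `x₊`. -/
def xp (q : K) (p : K[X]) : GWA K q p := gwaGen K q p 0
/-- The generator `x₋`. -/
def xm (q : K) (p : K[X]) : GWA K q p := gwaGen K q p 1
/-- The generator `z₊`. -/
def zp (q : K) (p : K[X]) : GWA K q p := gwaGen K q p 2
/-- The generator `z₋`. -/
def zm (q : K) (p : K[X]) : GWA K q p := gwaGen K q p 3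

/-- ℤ-degrees of the generators: `deg x₊ = deg z₊ = 1`, `deg x₋ = deg z₋ = -1`. -/
def gwaWt : Fin 4 → ℤ := ![1, -1, 1, -1]

/-- The total degree of a word in the generators. -/
def wordDeg (w : List (Fin 4)) : ℤ := (w.map gwaWt).sum

/-- The product in `A(p;q)` of the letters of a word. -/
def wordVal (q : K) (p : K[X]) (w : List (Fin 4)) : GWA K q p :=
  (w.map (gwaGen K q p)).prod

/-- The degree-`n` homogeneous component of the ℤ-graded algebra `A(p;q)`:
the `K`-linear span of the values of all words of total degree `n`. -/
def component (q : K) (p : K[X]) (n : ℤ) : Submodule K (GWA K q p) :=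
  Submodule.span K {a | ∃ w : List (Fin 4), wordDeg w = n ∧ wordVal K q p w = a}

/-- The `q²`-derivative `p_{q²}` of a polynomial `p`, equal to
`(p(q²z) - p(z))/((q²-1)z)` if `q² ≠ 1` and to `p'` if `q² = 1`. -/
def qDeriv (q : K) (p : K[X]) : K[X] :=
  if q ^ 2 = 1 then derivative p
  else (p.comp (C (q ^ 2) * X) - p) / (C (q ^ 2 - 1) * X)

/-- The polynomial `c(z) = q·p_{q²}(z)`. -/
def cPoly (q : K) (p : K[X]) : K[X] := C q * qDeriv K q p

/-- `p` is `q²`-separable: `p(z)` is coprime with `z·p_{q²}(z)`. -/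
def QSeparable (q : K) (p : K[X]) : Prop := IsCoprime p (X * qDeriv K q p)


/-- Polynomials in intertwined elements are intertwined. -/
theorem mul_aeval_eq_aeval_mul {F A : Type*} [Field F] [Ring A] [Algebra F A] {a s t : A}
    (h : a * s = t * a) (f : F[X]) : a * aeval s f = aeval t f * a := by
  induction f using Polynomial.induction_on' with
  | add f g hf hg => simp only [map_add, mul_add, add_mul, hf, hg]
  | monomial n c =>
    have hn : a * s ^ n = t ^ n * a := SemiconjBy.pow_right (show SemiconjBy a s t from h) n
    simp only [aeval_monomial]
    rw [← mul_assoc, ← Algebra.commutes, mul_assoc, hn, mul_assoc]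

section Relations

variable (q : K) (p : K[X])

theorem zp_mul_zm : zp K q p * zm K q p = zm K q p * zp K q p := by
  have h := RingQuot.mkAlgHom_rel K (GWARel.zz (q := q) (p := p))
  rw [map_mul, map_mul] at h
  exact h

theorem xp_mul_zp : xp K q p * zp K q p = q⁻¹ • (zp K q p * xp K q p) := by
  have h := RingQuot.mkAlgHom_rel K (GWARel.xpzp (q := q) (p := p))
  rw [map_mul, map_smul, map_mul] at h
  exact h

theorem xp_mul_zm : xp K q p * zm K q p = q⁻¹ • (zm K q p * xp K q p) := by
  have h := RingQuot.mkAlgHom_rel K (GWARel.xpzm (q := q) (p := p))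
  rw [map_mul, map_smul, map_mul] at h
  exact h

theorem xm_mul_zp : xm K q p * zp K q p = q • (zp K q p * xm K q p) := by
  have h := RingQuot.mkAlgHom_rel K (GWARel.xmzp (q := q) (p := p))
  rw [map_mul, map_smul, map_mul] at h
  exact h

theorem xm_mul_zm : xm K q p * zm K q p = q • (zm K q p * xm K q p) := by
  have h := RingQuot.mkAlgHom_rel K (GWARel.xmzm (q := q) (p := p))
  rw [map_mul, map_smul, map_mul] at h
  exact h

theorem xp_mul_xm : xp K q p * xm K q p = aeval (zm K q p * zp K q p) p := by
  have h := RingQuot.mkAlgHom_rel K (GWARel.xpxm (q := q) (p := p))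
  rw [map_mul, ← aeval_algHom_apply, map_mul] at h
  rw [← zp_mul_zm]
  exact h

theorem xm_mul_xp :
    xm K q p * xp K q p = aeval ((q ^ 2 : K) • (zm K q p * zp K q p)) p := by
  have h := RingQuot.mkAlgHom_rel K (GWARel.xmxp (q := q) (p := p))
  rw [map_mul, ← aeval_algHom_apply, map_smul, map_mul] at h
  exact h

theorem zm_mul_z : zm K q p * (zm K q p * zp K q p) = zm K q p * zp K q p * zm K q p := by
  rw [mul_assoc, zp_mul_zm]

theorem zp_mul_z : zp K q p * (zm K q p * zp K q p) = zm K q p * zp K q p * zp K q p := by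
  rw [← mul_assoc, zp_mul_zm]

theorem xm_mul_z : xm K q p * (zm K q p * zp K q p) =
    ((q ^ 2 : K) • (zm K q p * zp K q p)) * xm K q p := by
  rw [← mul_assoc, xm_mul_zm, smul_mul_assoc, mul_assoc, xm_mul_zp, mul_smul_comm, smul_smul,
    smul_mul_assoc, mul_assoc, pow_two]

theorem xp_mul_smul_z (hq : q ≠ 0) :
    xp K q p * ((q ^ 2 : K) • (zm K q p * zp K q p)) = zm K q p * zp K q p * xp K q p := by
  rw [mul_smul_comm, ← mul_assoc, xp_mul_zm, smul_mul_assoc, mul_assoc, xp_mul_zp,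
    mul_smul_comm, smul_smul, smul_smul]
  rw [show q ^ 2 * q⁻¹ * q⁻¹ = 1 by field_simp, one_smul, mul_assoc]

theorem x_mul_z : xm K q p * zp K q p * (zm K q p * zp K q p) =
    ((q ^ 2 : K) • (zm K q p * zp K q p)) * (xm K q p * zp K q p) := by
  rw [mul_assoc, zp_mul_z, ← mul_assoc, xm_mul_z, mul_assoc]

theorem y_mul_smul_z (hq : q ≠ 0) :
    zm K q p * xp K q p * ((q ^ 2 : K) • (zm K q p * zp K q p)) =
      zm K q p * zp K q p * (zm K q p * xp K q p) := by
  rw [mul_assoc, xp_mul_smul_z K q p hq, ← mul_assoc, zm_mul_z, mul_assoc]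

theorem x_mul_y : xm K q p * zp K q p * (zm K q p * xp K q p) =
    ((q ^ 2 : K) • (zm K q p * zp K q p)) *
      aeval ((q ^ 2 : K) • (zm K q p * zp K q p)) p := by
  rw [← xm_mul_xp, ← mul_assoc _ (xm K q p), ← xm_mul_z, ← zp_mul_zm]
  simp only [mul_assoc]

theorem y_mul_x : zm K q p * xp K q p * (xm K q p * zp K q p) =
    zm K q p * zp K q p * aeval (zm K q p * zp K q p) p := by
  rw [mul_assoc, ← mul_assoc (xp K q p), xp_mul_xm,
    ← mul_aeval_eq_aeval_mul (zp_mul_z K q p), mul_assoc]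

end Relations

section DegreeZero

variable (q : K) (p : K[X])

theorem mul_mem_component {m n : ℤ} {a b : GWA K q p} (ha : a ∈ component K q p m)
    (hb : b ∈ component K q p n) : a * b ∈ component K q p (m + n) := by
  have h := Submodule.mul_mem_mul ha hb
  rw [component, component, Submodule.span_mul_span] at h
  refine Submodule.span_mono ?_ h
  rintro _ ⟨_, ⟨u, rfl, rfl⟩, _, ⟨v, rfl, rfl⟩, rfl⟩
  exact ⟨u ++ v, by simp [wordDeg], by simp [wordVal]⟩

/-- The degree-zero component as a subalgebra of `A(p;q)`. -/
def degreeZero : Subalgebra K (GWA K q p) :=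
  (component K q p 0).toSubalgebra
    (Submodule.subset_span ⟨[], by simp [wordDeg], by simp [wordVal]⟩)
    fun _ _ ha hb => by simpa only [add_zero] using mul_mem_component K q p ha hb

theorem gen_mul_gen_mem_degreeZero {i j : Fin 4} (h : gwaWt i + gwaWt j = 0) :
    gwaGen K q p i * gwaGen K q p j ∈ degreeZero K q p :=
  Submodule.subset_span ⟨[i, j], by simpa [wordDeg] using h, by simp [wordVal]⟩

end DegreeZero

section Idempotent

variable {F A : Type*} [Field F] [Ring A] [Algebra F A]

/-- A scaled block matrix is idempotent if its entries satisfy the relations of the line-bundle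
projection. -/
theorem isIdempotentElem_smul_fin_two {c : F} (hc : c ≠ 0) {a b d e : A}
    (h₁ : a * a + b * d = c • a) (h₂ : a * b + b * e = c • b)
    (h₃ : d * a + e * d = c • d) (h₄ : d * b + e * e = c • e) :
    IsIdempotentElem (c⁻¹ • !![a, b; d, e]) := by
  have h : !![a, b; d, e] * !![a, b; d, e] = c • !![a, b; d, e] := by
    rw [Matrix.mul_fin_two, h₁, h₂, h₃, h₄]
    simp
  rw [IsIdempotentElem, smul_mul_smul_comm, h, smul_smul, mul_assoc, inv_mul_cancel₀ hc, mul_one]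

end Idempotent

/-- The matrices `e(1)` and `e(−1)` are idempotents in `M₂(B)` with
`e(1) + e(−1) = 1`, where `x = x₋z₊`, `y = z₋x₊`, `z = z₋z₊` and `p(z) = p(0) − z·w(z)`. -/
theorem idempotents_for_line_bundles [CharZero K]
    (q : K) (hq : q ≠ 0) (p : K[X])
    (hp0 : p.eval 0 ≠ 0)
    (w : K[X]) (hw : p = C (p.eval 0) - X * w) :
    ∀ e1 em : Matrix (Fin 2) (Fin 2) (GWA K q p),
      e1 = (p.eval 0)⁻¹ •
        !![algebraMap K (GWA K q p) (p.eval 0) - aeval ((q ^ 2 : K) • (zm K q p * zp K q p)) p,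
            -(xm K q p * zp K q p);
          -(aeval (zm K q p * zp K q p) w * (zm K q p * xp K q p)),
            aeval (zm K q p * zp K q p) p] →
      em = (p.eval 0)⁻¹ •
        !![aeval ((q ^ 2 : K) • (zm K q p * zp K q p)) p, xm K q p * zp K q p;
          aeval (zm K q p * zp K q p) w * (zm K q p * xp K q p),
            algebraMap K (GWA K q p) (p.eval 0) - aeval (zm K q p * zp K q p) p] →
      (e1 * e1 = e1 ∧ em * em = em ∧ e1 + em = 1 ∧
        (∀ i j, e1 i j ∈ component K q p 0) ∧ (∀ i j, em i j ∈ component K q p 0)) := by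
  rintro _ _ rfl rfl
  set c := p.eval 0
  set z := zm K q p * zp K q p with hz
  set x := xm K q p * zp K q p
  set y := zm K q p * xp K q p
  set P := aeval z p with hP
  set Q := aeval ((q ^ 2 : K) • z) p
  set W := aeval z w with hW
  have aeval_p (s : GWA K q p) : aeval s p = algebraMap K _ c - s * aeval s w :=
    (congrArg (aeval s) hw).trans (by simp)
  have hxP : x * P = Q * x := mul_aeval_eq_aeval_mul (x_mul_z K q p) p
  have hxW : x * W = aeval ((q ^ 2 : K) • z) w * x := mul_aeval_eq_aeval_mul (x_mul_z K q p) w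
  have hyQ : y * Q = P * y := mul_aeval_eq_aeval_mul (y_mul_smul_z K q p hq) p
  have hWP : W * P = P * W := by rw [hW, hP, ← map_mul, ← map_mul, mul_comm]
  have hWz : W * z = z * W := (mul_aeval_eq_aeval_mul rfl w).symm
  have hQQ : Q * Q + x * (W * y) = c • Q := by
    rw [← mul_assoc, hxW, mul_assoc, x_mul_y, ← mul_assoc, ← add_mul,
      ← mul_aeval_eq_aeval_mul rfl w, eq_sub_iff_add_eq.mp (aeval_p _ : Q = _),
      ← Algebra.smul_def]
  have hPP : W * y * x + (algebraMap K _ c - P) * (algebraMap K _ c - P) =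
      c • (algebraMap K _ c - P) := by
    have hzW : z * W = algebraMap K _ c - P := by rw [hP, aeval_p, sub_sub_cancel]
    rw [mul_assoc, y_mul_x, ← mul_assoc, hWz, hzW, ← hz, ← hP, mul_sub _ _ P, ← Algebra.commutes,
      add_sub_cancel, ← Algebra.smul_def]
  have hem : IsIdempotentElem (c⁻¹ • !![Q, x; W * y, algebraMap K (GWA K q p) c - P]) := by
    refine isIdempotentElem_smul_fin_two hp0 hQQ ?_ ?_ hPP
    · rw [mul_sub, hxP, ← Algebra.commutes, ← Algebra.smul_def]
      abel
    · rw [mul_assoc, hyQ, sub_mul, ← mul_assoc, hWP, mul_assoc, ← Algebra.smul_def]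
      abel
  have hsum : c⁻¹ • !![algebraMap K (GWA K q p) c - Q, -x; -(W * y), P] +
      c⁻¹ • !![Q, x; W * y, algebraMap K (GWA K q p) c - P] = 1 := by
    rw [← smul_add, Matrix.one_fin_two]
    ext i j
    fin_cases i <;> fin_cases j <;> simp [Algebra.algebraMap_eq_smul_one, smul_smul, hp0, c]
  have hz0 : z ∈ degreeZero K q p := gen_mul_gen_mem_degreeZero K q p (i := 3) (j := 2) rfl
  have hx0 : x ∈ degreeZero K q p := gen_mul_gen_mem_degreeZero K q p (i := 1) (j := 2) rfl
  have hy0 : y ∈ degreeZero K q p := gen_mul_gen_mem_degreeZero K q p (i := 3) (j := 0) rfl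
  have aeval_mem {s : GWA K q p} (hs : s ∈ degreeZero K q p) (f : K[X]) :
      aeval s f ∈ degreeZero K q p :=
    Algebra.adjoin_le (Set.singleton_subset_iff.mpr hs) (aeval_mem_adjoin_singleton K s)
  have hc0 := (degreeZero K q p).algebraMap_mem c
  have hP0 : P ∈ degreeZero K q p := aeval_mem hz0 p
  have hQ0 : Q ∈ degreeZero K q p := aeval_mem ((degreeZero K q p).smul_mem hz0 _) p
  have hWy0 : W * y ∈ degreeZero K q p := mul_mem (aeval_mem hz0 w) hy0
  refine ⟨?_, hem, hsum, ?_, ?_⟩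
  · rw [eq_sub_of_add_eq hsum]
    exact hem.one_sub
  · intro i j
    refine (component K q p 0).smul_mem _ (?_ : _ ∈ degreeZero K q p)
    fin_cases i <;> fin_cases j
    exacts [sub_mem hc0 hQ0, neg_mem hx0, neg_mem hWy0, hP0]
  · intro i j
    refine (component K q p 0).smul_mem _ (?_ : _ ∈ degreeZero K q p)
    fin_cases i <;> fin_cases j
    exacts [hQ0, hx0, hWy0, sub_mem hc0 hP0]

end GWAPaper
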